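/- arXiv:cond-mat/0108432 — 3 statements merged into one kernel-verified Lean document; each statement's English description precedes it below -/
import Mathlib

section
/- Let G be a finite simple graph with adjacency matrix Adj(G), k ≥ 2, and let v_0, v_1, …, v_{2k−1} be distinct vertices such that: (i) v_i is adjacent to v_{i+1 mod 2k} for all i; (ii) no two non-consecutive vertices of the cycle are adjacent; and (iii) for every vertex w not on the cycle, Σ_{i : w adjacent to v_i} (−1)^i = 0. Then the vector x ∈ ℝ^V with x(v_i) = (−1)^i and x(w) = 0 for w off the cycle is nonzero and satisfies Adj(G)·x = −2·x; in particular −2 is an eigenvalue of Adj(G) with an eigenvector supported on the cycle (a localized one-magnon state). -/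
open Matrix

/-- Reducing an exponent modulo an even number does not change a power of `-1`. -/
theorem neg_one_pow_mod_two_mul {R : Type*} [Ring R] (n k : ℕ) :
    (-1 : R) ^ (n % (2 * k)) = (-1) ^ n := by
  conv_rhs => rw [← Nat.mod_add_div n (2 * k), pow_add, mul_assoc, pow_mul]
  simp

/-- The action of the adjacency matrix on a vector supported on the image of an injective
finite family of vertices. -/
theorem adjMatrix_mulVec_apply_of_support {V R : Type*} [Fintype V] [DecidableEq V]
    [NonAssocSemiring R] (G : SimpleGraph V) [DecidableRel G.Adj] (n : ℕ) (v : ℕ → V)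
    (hinj : ∀ i < n, ∀ m < n, v i = v m → i = m) (x : V → R)
    (hx0 : ∀ w : V, (∀ i < n, w ≠ v i) → x w = 0) (w : V) :
    (G.adjMatrix R *ᵥ x) w =
      ∑ i ∈ Finset.range n, if G.Adj w (v i) then x (v i) else 0 := by
  have himage : ∑ u ∈ (Finset.range n).image v, (if G.Adj w u then x u else 0) =
      ∑ i ∈ Finset.range n, if G.Adj w (v i) then x (v i) else 0 :=
    Finset.sum_image fun i hi m hm h =>
      hinj i (by simpa using hi) m (by simpa using hm) h
  rw [← himage, SimpleGraph.adjMatrix_mulVec_apply, SimpleGraph.neighborFinset_eq_filter,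
    Finset.sum_filter]
  refine (Finset.sum_subset (Finset.subset_univ _) fun u _ hu => ?_).symm
  have hxu : x u = 0 := hx0 u fun i hi h =>
    hu (Finset.mem_image.2 ⟨i, Finset.mem_range.2 hi, h.symm⟩)
  simp [hxu]

/-- In a cycle of length `n`, the index `i` is preceded by `(i + (n - 1)) % n`. -/
theorem succ_mod_eq_iff {n i j : ℕ} (hi : i < n) (hj : j < n) :
    (i + 1) % n = j ↔ i = (j + (n - 1)) % n := by
  rcases Nat.eq_zero_or_pos j with rfl | hj0
  · rw [Nat.zero_add, Nat.mod_eq_of_lt (by omega : n - 1 < n)]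
    rcases Nat.lt_or_ge (i + 1) n with h | h
    · rw [Nat.mod_eq_of_lt h]; omega
    · rw [show i + 1 = n by omega, Nat.mod_self]; omega
  · rw [show j + (n - 1) = j - 1 + n by omega, Nat.add_mod_right,
      Nat.mod_eq_of_lt (by omega : j - 1 < n)]
    rcases Nat.lt_or_ge (i + 1) n with h | h
    · rw [Nat.mod_eq_of_lt h]; omega
    · rw [show i + 1 = n by omega, Nat.mod_self]; omega

/-- In a cycle of length at least three, successor and predecessor differ. -/
theorem succ_mod_succ_mod_ne {n j : ℕ} (hn : 3 ≤ n) (hj : j < n) :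
    ((j + 1) % n + 1) % n ≠ j := by
  rw [Nat.mod_add_mod]
  rcases Nat.lt_or_ge (j + 1 + 1) n with h | h
  · rw [Nat.mod_eq_of_lt h]; omega
  · rw [Nat.mod_eq_sub_mod h, Nat.mod_eq_of_lt (by omega)]; omega

/-- An even cycle `v_0, …, v_{2k−1}` in `G` (chordless within the cycle) such that every
off-cycle vertex has alternating neighbour sum zero supports a localized one-magnon state:
the alternating vector `x` is a nonzero eigenvector of `Adj(G)` with eigenvalue `−2`. -/
theorem localized_one_magnon {V : Type*} [Fintype V] [DecidableEq V]
    (G : SimpleGraph V) [DecidableRel G.Adj] (k : ℕ) (hk : 2 ≤ k)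
    (v : ℕ → V)
    (hinj : ∀ i < 2*k, ∀ m < 2*k, v i = v m → i = m)
    (hadj : ∀ i < 2*k, G.Adj (v i) (v ((i + 1) % (2*k))))
    (hnonadj : ∀ i < 2*k, ∀ m < 2*k,
      (i + 1) % (2*k) ≠ m → (m + 1) % (2*k) ≠ i → ¬ G.Adj (v i) (v m))
    (hoff : ∀ w : V, (∀ i < 2*k, w ≠ v i) →
      ∑ i ∈ Finset.range (2*k), (if G.Adj w (v i) then ((-1 : ℝ))^i else 0) = 0)
    (x : V → ℝ)
    (hx : ∀ i < 2*k, x (v i) = (-1 : ℝ)^i)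
    (hx0 : ∀ w : V, (∀ i < 2*k, w ≠ v i) → x w = 0) :
    x ≠ 0 ∧ G.adjMatrix ℝ *ᵥ x = (-2 : ℝ) • x := by
  have hpos : 0 < 2 * k := by omega
  refine ⟨fun h => by simpa [h] using hx 0 hpos, ?_⟩
  funext w
  rw [adjMatrix_mulVec_apply_of_support G (2 * k) v hinj x hx0 w]
  have hsum : ∑ i ∈ Finset.range (2 * k), (if G.Adj w (v i) then x (v i) else 0) =
      ∑ i ∈ Finset.range (2 * k), if G.Adj w (v i) then (-1 : ℝ) ^ i else 0 :=
    Finset.sum_congr rfl fun i hi => by rw [hx i (Finset.mem_range.1 hi)]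
  rw [hsum, Pi.smul_apply, smul_eq_mul]
  by_cases hw : ∀ i < 2 * k, w ≠ v i
  · rw [hoff w hw, hx0 w hw, mul_zero]
  push Not at hw
  obtain ⟨j, hj, rfl⟩ := hw
  have hne := succ_mod_succ_mod_ne (by omega : 3 ≤ 2 * k) hj
  have hterm : ∀ i ∈ Finset.range (2 * k), (if G.Adj (v j) (v i) then (-1 : ℝ) ^ i else 0) =
      (if i = (j + 1) % (2 * k) then -(-1 : ℝ) ^ j else 0) +
        if i = (j + (2 * k - 1)) % (2 * k) then -(-1 : ℝ) ^ j else 0 := by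
    intro i hi
    replace hi := Finset.mem_range.1 hi
    simp only [← succ_mod_eq_iff hi hj]
    by_cases hsucc : i = (j + 1) % (2 * k)
    · have hpred : ¬ (i + 1) % (2 * k) = j := by rwa [hsucc]
      have hji : G.Adj (v j) (v i) := hsucc ▸ hadj j hj
      rw [if_pos hji, if_pos hsucc, if_neg hpred, hsucc, neg_one_pow_mod_two_mul, pow_succ]
      ring
    · by_cases hpred : (i + 1) % (2 * k) = j
      · have hji : G.Adj (v j) (v i) := hpred ▸ (hadj i hi).symm
        rw [if_pos hji, if_neg hsucc, if_pos hpred, ← hpred, neg_one_pow_mod_two_mul, pow_succ]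
        ring
      · rw [if_neg (hnonadj j hj i hi (Ne.symm hsucc) hpred), if_neg hsucc, if_neg hpred,
          add_zero]
  rw [Finset.sum_congr rfl hterm, Finset.sum_add_distrib, Finset.sum_ite_eq',
    Finset.sum_ite_eq', if_pos (Finset.mem_range.2 (Nat.mod_lt _ hpos)),
    if_pos (Finset.mem_range.2 (Nat.mod_lt _ hpos)), hx j hj]
  ring
end

section
/- (Proposition 1) Let σ and τ be isolated configurations, each with exactly a down spins. Then ⟨e_σ, H e_τ⟩ = ((1−a)·N·j/8)·[σ = τ] + ⟨𝒥_a e_σ, K_a 𝒥_a e_τ⟩; that is, restricted to the subspace ℋ_a^{iso} spanned by isolated configurations, H = (1−a)·N·j/8 · Id + 𝒥_a* K_a 𝒥_a. -/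
open Matrix BigOperators
open scoped ComplexOrder

/-- Spin-1/2 configurations: `true` means spin down. -/
abbrev Conf (V : Type*) := V → Bool

variable {V : Type*}

/-- The operator `P_{uv}` interchanging the spin values at sites `u` and `v`. -/
noncomputable def swapOp [Fintype V] [DecidableEq V] (u v : V) :
    Matrix (Conf V) (Conf V) ℂ :=
  Matrix.of fun σ τ => if τ = σ ∘ (Equiv.swap u v) then 1 else 0

lemma swapOp_comm [Fintype V] [DecidableEq V] (u v : V) :
    swapOp (V := V) u v = swapOp v u := by
  unfold swapOp
  rw [Equiv.swap_comm]

/-- The spin-1/2 Heisenberg Hamiltonian `H = Σ_{{u,v} ∈ E(G)} ((1/2)·P_{uv} − (1/4)·Id)`. -/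
noncomputable def Ham [Fintype V] [DecidableEq V] (G : SimpleGraph V) [DecidableRel G.Adj] :
    Matrix (Conf V) (Conf V) ℂ :=
  ∑ e ∈ G.edgeFinset,
    Sym2.lift ⟨fun u v => (1/2 : ℂ) • swapOp u v - (1/4 : ℂ) • 1,
      fun u v => by dsimp only; rw [swapOp_comm]⟩ e

/-- The configuration `σ_n` whose single down spin is at `n`. -/
def singleDown [DecidableEq V] (n : V) : Conf V := fun w => decide (w = n)

/-- The one-magnon block `H₁` of `H`, as a matrix indexed by `V`
(via the identification `e_{σ_n} ↦ e_n`). -/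
noncomputable def H1 [Fintype V] [DecidableEq V] (G : SimpleGraph V) [DecidableRel G.Adj] :
    Matrix V V ℂ :=
  Matrix.of fun m n => Ham G (singleDown m) (singleDown n)

/-- Number of down spins `|A_σ|` of a configuration. -/
def downCard [Fintype V] (σ : Conf V) : ℕ := (Finset.univ.filter fun u => σ u = true).card

/-- `e(A_σ, V∖A_σ)`: the number of edges joining the down-set to its complement. -/
noncomputable def crossCount (G : SimpleGraph V) (σ : Conf V) : ℕ :=
  {e : Sym2 V | e ∈ G.edgeSet ∧ ∃ u v : V, σ u = true ∧ σ v = false ∧ e = s(u, v)}.ncard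

/-- `e(A_σ)`: the number of edges with both endpoints in the down-set. -/
noncomputable def inCount (G : SimpleGraph V) (σ : Conf V) : ℕ :=
  {e : Sym2 V | e ∈ G.edgeSet ∧ ∀ u ∈ e, σ u = true}.ncard

/-- The `a`-fold Kronecker sum `K_a` of a matrix `M`. -/
noncomputable def kron {W : Type*} [Fintype W] [DecidableEq W] (a : ℕ) (M : Matrix W W ℂ) :
    Matrix (Fin a → W) (Fin a → W) ℂ :=
  Matrix.of fun f g =>
    ∑ i, M (f i) (g i) * ∏ j ∈ Finset.univ.erase i, (if f j = g j then (1 : ℂ) else 0)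

/-- The isometric embedding `𝒥_a : ℋ_a → ((Fin a → V) → ℂ)`,
`𝒥_a e_σ = (a!)^{-1/2} Σ_f e_f`, `f` ranging over bijections `Fin a → A_σ`. -/
noncomputable def Ja [Fintype V] [DecidableEq V] (a : ℕ) :
    Matrix (Fin a → V) (Conf V) ℂ :=
  Matrix.of fun f σ =>
    if Function.Injective f ∧ (∀ u, σ u = true ↔ ∃ i, f i = u)
    then (Real.sqrt (Nat.factorial a) : ℂ)⁻¹ else 0

/-- A sum over ordered pairs of adjacent vertices counts every edge twice. -/
lemma sum_adj_eq_two_mul_sum_edgeFinset [Fintype V] [DecidableEq V] (G : SimpleGraph V)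
    [DecidableRel G.Adj] (F : Sym2 V → ℂ) :
    ∑ x, ∑ y, (if G.Adj x y then F s(x, y) else 0) = 2 * ∑ e ∈ G.edgeFinset, F e := by
  rw [← Fintype.sum_prod_type' (fun x y => if G.Adj x y then F s(x, y) else 0),
    ← Finset.sum_filter, ← Finset.sum_fiberwise_of_maps_to (t := G.edgeFinset)
      (g := fun p : V × V => s(p.1, p.2)) (by intro p hp; simpa using hp), Finset.mul_sum]
  refine Finset.sum_congr rfl fun e he => ?_
  induction e using Sym2.inductionOn with
  | _ u v =>
    have huv : G.Adj u v := by simpa using he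
    have hfib : (Finset.univ.filter fun p : V × V => G.Adj p.1 p.2).filter
        (fun p => s(p.1, p.2) = s(u, v)) = {(u, v), (v, u)} := by
      ext ⟨x, y⟩
      simp only [Finset.mem_filter, Finset.mem_univ, true_and, Sym2.eq_iff, Finset.mem_insert,
        Finset.mem_singleton, Prod.mk.injEq]
      constructor
      · exact fun h => h.2
      · rintro (⟨rfl, rfl⟩ | ⟨rfl, rfl⟩)
        · exact ⟨huv, Or.inl ⟨rfl, rfl⟩⟩
        · exact ⟨huv.symm, Or.inr ⟨rfl, rfl⟩⟩
    rw [hfib, Finset.sum_pair (by simp [huv.ne]), Sym2.eq_swap (a := v), two_mul]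

lemma Conf.comp_swap_eq_self [DecidableEq V] {σ : Conf V} {u v : V} (h : σ u = σ v) :
    σ ∘ Equiv.swap u v = σ := by
  ext w
  rw [Function.comp_apply, Equiv.swap_apply_def]
  split_ifs with h1 h2
  · rw [h1, h]
  · rw [h2, h]
  · rfl

lemma sum_adj_eq_degree [Fintype V] {G : SimpleGraph V} [DecidableRel G.Adj] {j : ℕ}
    (hreg : G.IsRegularOfDegree j) (x : V) :
    ∑ y, (if G.Adj x y then (1 : ℂ) else 0) = j := by
  rw [Finset.sum_boole, ← hreg x, ← G.card_neighborFinset_eq_degree, G.neighborFinset_eq_filter]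

/-- Matrix elements of the Hamiltonian in the row of an isolated configuration. -/
lemma ham_apply_of_isolated [Fintype V] [DecidableEq V] (G : SimpleGraph V)
    [DecidableRel G.Adj] {j : ℕ} (hreg : G.IsRegularOfDegree j) (σ τ : Conf V)
    (hσ : ∀ u v : V, σ u = true → σ v = true → ¬ G.Adj u v) :
    Ham G σ τ
      = 1 / 2 * ∑ x, ∑ y, (if σ x = true ∧ σ y = false ∧ τ = σ ∘ Equiv.swap x y ∧ G.Adj x y
          then (1 : ℂ) else 0)
        + ((Fintype.card V : ℂ) * j / 8 - (downCard σ : ℂ) * j / 2) *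
          (if σ = τ then 1 else 0) := by
  have hedge := sum_adj_eq_two_mul_sum_edgeFinset G fun e =>
    (Sym2.lift ⟨fun u v => (1/2 : ℂ) • swapOp u v - (1/4 : ℂ) • (1 : Matrix (Conf V) (Conf V) ℂ),
      fun u v => by dsimp only; rw [swapOp_comm]⟩ e) σ τ
  rw [← Matrix.sum_apply] at hedge
  change _ = 2 * Ham G σ τ at hedge
  set hop : V → V → ℂ := fun x y =>
    if σ x = true ∧ σ y = false ∧ τ = σ ∘ Equiv.swap x y ∧ G.Adj x y then 1 else 0 with hhop
  set δ : ℂ := if σ = τ then 1 else 0 with hδ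
  set adj : V → V → ℂ := fun x y => if G.Adj x y then 1 else 0 with hadj
  set down : V → ℂ := fun x => if σ x = true then 1 else 0 with hdown
  have hterm : ∀ x y, (if G.Adj x y then
      (Sym2.lift ⟨fun u v => (1/2 : ℂ) • swapOp u v -
        (1/4 : ℂ) • (1 : Matrix (Conf V) (Conf V) ℂ),
        fun u v => by dsimp only; rw [swapOp_comm]⟩ s(x, y)) σ τ else 0)
      = 1 / 2 * hop x y + 1 / 2 * hop y x +
        (1 / 4 * adj x y - 1 / 2 * (down x * adj x y) - 1 / 2 * (down y * adj y x)) * δ := by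
    intro x y
    by_cases hxy : G.Adj x y
    · have hiso := hσ x y
      simp only [hxy, hxy.symm, if_true, Sym2.lift_mk, Matrix.sub_apply, Matrix.smul_apply,
        swapOp, Matrix.of_apply, Matrix.one_apply, smul_eq_mul, hhop, hδ, hadj, hdown, and_true,
        Equiv.swap_comm y x]
      cases hx : σ x <;> cases hy : σ y
      · rw [Conf.comp_swap_eq_self (hx.trans hy.symm)]
        by_cases h : σ = τ
        · simp [h]; norm_num
        · simp [h, Ne.symm h]
      · simp; split_ifs <;> norm_num
      · simp; split_ifs <;> norm_num
      · exact absurd hxy (hiso hx hy)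
    · have hyx : ¬ G.Adj y x := fun h => hxy h.symm
      simp [hxy, hyx, hhop, hadj]
  simp only [hterm, Finset.sum_add_distrib, Finset.sum_sub_distrib, ← Finset.mul_sum,
    ← Finset.sum_mul] at hedge
  rw [Finset.sum_comm (f := fun x y => hop y x),
    Finset.sum_comm (f := fun x y => down y * adj y x)] at hedge
  have hdeg : ∀ x, ∑ y, adj x y = j := sum_adj_eq_degree hreg
  have hcard : ∑ x, down x = (downCard σ : ℂ) := by
    simp only [hdown, Finset.sum_boole, downCard]
  simp only [← Finset.mul_sum, hdeg, ← Finset.sum_mul, hcard, Finset.sum_const, Finset.card_univ,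
    nsmul_eq_mul] at hedge
  linear_combination (-1 / 2 : ℂ) * hedge

lemma singleDown_injective [DecidableEq V] : Function.Injective (singleDown (V := V)) := by
  intro m n h
  simpa [singleDown] using congrFun h m

lemma singleDown_comp_swap [DecidableEq V] (m n : V) :
    singleDown m ∘ Equiv.swap m n = singleDown n := by
  ext w
  simp [singleDown, Equiv.swap_apply_eq_iff]

/-- The one-magnon Hamiltonian in terms of the adjacency matrix. -/
lemma H1_apply [Fintype V] [DecidableEq V] (G : SimpleGraph V)
    [DecidableRel G.Adj] {j : ℕ} (hreg : G.IsRegularOfDegree j) (m n : V) :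
    H1 G m n = 1 / 2 * (if G.Adj m n then 1 else 0)
      + ((Fintype.card V : ℂ) * j / 8 - (j : ℂ) / 2) * (if m = n then 1 else 0) := by
  have hcard : downCard (singleDown m) = 1 := by
    simp [downCard, singleDown, Finset.filter_eq']
  have hiso : ∀ u v : V, singleDown m u = true → singleDown m v = true → ¬ G.Adj u v := by
    intro u v hu hv
    simp only [singleDown, decide_eq_true_eq] at hu hv
    simp [hu, hv]
  rw [H1, Matrix.of_apply, ham_apply_of_isolated G hreg _ _ hiso, hcard]
  have hsum : ∑ x, ∑ y, (if singleDown m x = true ∧ singleDown m y = false ∧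
      singleDown n = singleDown m ∘ Equiv.swap x y ∧ G.Adj x y then (1 : ℂ) else 0)
      = if G.Adj m n then 1 else 0 := by
    rw [Fintype.sum_eq_single m (fun x hx => by simp [singleDown, hx]),
      Fintype.sum_eq_single n]
    · rw [singleDown_comp_swap]
      by_cases h : G.Adj m n
      · simp [h, singleDown, h.ne']
      · simp [h]
    · intro y hy
      rw [singleDown_comp_swap, if_neg]
      exact fun h => hy (singleDown_injective h.2.2.1).symm
  simp only [hsum, singleDown_injective.eq_iff, Nat.cast_one, one_mul]

/-- The Kronecker sum acts by changing one coordinate at a time. -/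
lemma kron_mulVec_apply {W : Type*} [Fintype W] [DecidableEq W] (a : ℕ) (M : Matrix W W ℂ)
    (w : (Fin a → W) → ℂ) (f : Fin a → W) :
    (kron a M *ᵥ w) f = ∑ i, ∑ y, M (f i) y * w (Function.update f i y) := by
  simp only [Matrix.mulVec, dotProduct, kron, Matrix.of_apply, Finset.sum_mul]
  rw [Finset.sum_comm]
  refine Finset.sum_congr rfl fun i _ => ?_
  symm
  refine Fintype.sum_of_injective (Function.update f i) (Function.update_injective f i) _ _ ?_ ?_
  · intro g hg
    have hne : ∃ k ∈ Finset.univ.erase i, f k ≠ g k := by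
      by_contra! hcon
      refine hg ⟨g i, ?_⟩
      ext k
      by_cases hk : k = i
      · subst hk; simp
      · rw [Function.update_of_ne hk]
        exact hcon k (by simp [hk])
    obtain ⟨k, hk, hfg⟩ := hne
    rw [Finset.prod_eq_zero hk (if_neg hfg)]
    simp
  · intro y
    rw [Finset.prod_eq_one]
    · simp
    · intro k hk
      rw [Function.update_of_ne (Finset.ne_of_mem_erase hk), if_pos rfl]

/-- `f` enumerates the down-set of `σ` without repetition. -/
def IsDownEnum {a : ℕ} (f : Fin a → V) (σ : Conf V) : Prop :=
  Function.Injective f ∧ ∀ u, σ u = true ↔ ∃ i, f i = u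

lemma IsDownEnum.unique {a : ℕ} {f : Fin a → V} {σ τ : Conf V}
    (hσ : IsDownEnum f σ) (hτ : IsDownEnum f τ) : σ = τ := by
  ext u
  rw [Bool.eq_iff_iff, hσ.2, hτ.2]

lemma IsDownEnum.comp_perm {a : ℕ} {f : Fin a → V} {σ : Conf V} (h : IsDownEnum f σ)
    (e : Equiv.Perm V) : IsDownEnum (e ∘ f) (σ ∘ e.symm) := by
  refine ⟨e.injective.comp h.1, fun u => ?_⟩
  simp only [Function.comp_apply, h.2, Equiv.eq_symm_apply]

lemma IsDownEnum.update_iff [DecidableEq V] {a : ℕ} {f : Fin a → V} {σ : Conf V}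
    (h : IsDownEnum f σ) (i : Fin a) (y : V) (τ : Conf V) :
    IsDownEnum (Function.update f i y) τ ↔
      (y = f i ∨ σ y = false) ∧ τ = σ ∘ Equiv.swap (f i) y := by
  have key : (y = f i ∨ σ y = false) →
      IsDownEnum (Function.update f i y) (σ ∘ Equiv.swap (f i) y) := by
    intro hy
    have hup : Function.update f i y = Equiv.swap (f i) y ∘ f := by
      ext k
      by_cases hk : k = i
      · subst hk; simp
      · have hne : f k ≠ f i := h.1.ne hk
        have hney : f k ≠ y := by
          rintro rfl
          rcases hy with hy | hy
          · exact hne hy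
          · rw [(h.2 _).2 ⟨k, rfl⟩] at hy
            cases hy
        rw [Function.update_of_ne hk, Function.comp_apply, Equiv.swap_apply_of_ne_of_ne hne hney]
    rw [hup]
    simpa using h.comp_perm (Equiv.swap (f i) y)
  constructor
  · intro hτ
    have hy : y = f i ∨ σ y = false := by
      cases hσy : σ y
      · exact Or.inr rfl
      · obtain ⟨k, hk⟩ := (h.2 y).1 hσy
        by_cases hki : k = i
        · exact Or.inl (hki ▸ hk.symm)
        · exact absurd (hτ.1 (by simp [Function.update_of_ne hki, hk])) hki
    exact ⟨hy, hτ.unique (key hy)⟩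
  · rintro ⟨hy, rfl⟩
    exact key hy

open Classical in
lemma card_isDownEnum [Fintype V] (σ : Conf V) :
    (Finset.univ.filter fun f : Fin (downCard σ) → V => IsDownEnum f σ).card
      = (downCard σ).factorial := by
  have hcard : Fintype.card (Fin (downCard σ)) = Fintype.card {u : V // σ u = true} := by
    rw [Fintype.card_fin, Fintype.card_subtype, downCard]
  have heq := Fintype.card_equiv (Fintype.equivOfCardEq hcard)
  rw [Fintype.card_fin] at heq
  rw [← heq, ← Finset.card_univ]
  symm
  refine Finset.card_bij (fun e _ i => (e i : V)) ?_ ?_ ?_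
  · intro e _
    simp only [Finset.mem_filter, Finset.mem_univ, true_and]
    refine ⟨Subtype.val_injective.comp e.injective, fun u => ⟨fun hu => ?_, ?_⟩⟩
    · exact ⟨e.symm ⟨u, hu⟩, by simp⟩
    · rintro ⟨i, rfl⟩
      exact (e i).2
  · intro e _ e' _ h
    ext i
    exact congrFun h i
  · intro f hf
    have hf : IsDownEnum f σ := by simpa using hf
    refine ⟨Equiv.ofBijective (fun i => ⟨f i, (hf.2 _).2 ⟨i, rfl⟩⟩) ⟨?_, ?_⟩,
      Finset.mem_univ _, rfl⟩
    · intro i k hik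
      exact hf.1 (congrArg Subtype.val hik)
    · rintro ⟨u, hu⟩
      obtain ⟨i, hi⟩ := (hf.2 u).1 hu
      exact ⟨i, Subtype.ext hi⟩

lemma IsDownEnum.sum_comp [Fintype V] {a : ℕ} {f : Fin a → V} {σ : Conf V}
    (h : IsDownEnum f σ) (F : V → ℂ) :
    ∑ i, F (f i) = ∑ x, if σ x = true then F x else 0 := by
  refine Fintype.sum_of_injective f h.1 _ _ (fun x hx => if_neg ?_) (fun i => (if_pos ?_).symm)
  · rwa [h.2]
  · exact (h.2 _).2 ⟨i, rfl⟩

open Classical in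
lemma Ja_apply [Fintype V] [DecidableEq V] (a : ℕ) (f : Fin a → V) (σ : Conf V) :
    Ja a f σ = if IsDownEnum f σ then (Real.sqrt (Nat.factorial a) : ℂ)⁻¹ else 0 := by
  exact if_congr Iff.rfl rfl rfl

/-- Matrix elements of `𝒥_a* K 𝒥_a` for the Kronecker sum `K` of `M`, with `a` the number of down
spins of the row configuration. -/
lemma star_Ja_dotProduct_kron_mulVec [Fintype V] [DecidableEq V] (M : Matrix V V ℂ)
    (σ τ : Conf V) :
    star (Ja (downCard σ) *ᵥ Pi.single σ 1) ⬝ᵥ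
        (kron (downCard σ) M *ᵥ (Ja (downCard σ) *ᵥ Pi.single τ 1))
      = ∑ x, if σ x = true then
          ∑ y, M x y * (if (y = x ∨ σ y = false) ∧ τ = σ ∘ Equiv.swap x y then 1 else 0)
        else 0 := by
  classical
  set S : ℂ := ∑ x, if σ x = true then
          ∑ y, M x y * (if (y = x ∨ σ y = false) ∧ τ = σ ∘ Equiv.swap x y then 1 else 0)
        else 0 with hS
  set c : ℂ := (Real.sqrt (Nat.factorial (downCard σ)) : ℂ)⁻¹ with hc
  have hcc : c * c * (Nat.factorial (downCard σ) : ℂ) = 1 := by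
    have hpos : (0 : ℝ) < Nat.factorial (downCard σ) := by positivity
    have hsq : (Real.sqrt (Nat.factorial (downCard σ)) : ℂ) *
        (Real.sqrt (Nat.factorial (downCard σ)) : ℂ) = (Nat.factorial (downCard σ) : ℂ) := by
      rw [← Complex.ofReal_mul, Real.mul_self_sqrt hpos.le, Complex.ofReal_natCast]
    rw [hc, ← mul_inv, hsq]
    exact inv_mul_cancel₀ (by exact_mod_cast hpos.ne')
  have hstar : star c = c := by simp [hc]
  have hterm : ∀ f : Fin (downCard σ) → V,
      star (Ja (downCard σ) f σ) *
        (∑ i, ∑ y, M (f i) y * Ja (downCard σ) (Function.update f i y) τ)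
      = if IsDownEnum f σ then c * c * S else 0 := by
    intro f
    simp only [Ja_apply, ← hc]
    by_cases hf : IsDownEnum f σ
    · simp only [if_pos hf, hf.update_iff, hstar, mul_assoc]
      congr 1
      rw [hS, ← hf.sum_comp, Finset.mul_sum]
      refine Finset.sum_congr rfl fun i _ => ?_
      rw [Finset.mul_sum]
      refine Finset.sum_congr rfl fun y _ => ?_
      split_ifs <;> ring
    · simp [hf]
  rw [dotProduct]
  simp only [kron_mulVec_apply, Pi.star_apply, Matrix.mulVec_single_one, Matrix.col_apply, hterm]
  rw [← Finset.sum_filter, Finset.sum_const, card_isDownEnum, nsmul_eq_mul]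
  linear_combination S * hcc

/-- (Proposition 1) For isolated configurations `σ`, `τ`, each with exactly `a` down spins,
`⟨e_σ, H e_τ⟩ = ((1−a)·N·j/8)·[σ = τ] + ⟨𝒥_a e_σ, K_a 𝒥_a e_τ⟩`. -/
theorem prop1_isolated [Fintype V] [DecidableEq V]
    (G : SimpleGraph V) [DecidableRel G.Adj] (N j : ℕ)
    (hN : Fintype.card V = N) (hreg : G.IsRegularOfDegree j)
    (a : ℕ) (ha : 1 ≤ a) (σ τ : Conf V)
    (hσa : downCard σ = a) (hτa : downCard τ = a)
    (hσiso : ∀ u v : V, σ u = true → σ v = true → ¬ G.Adj u v)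
    (hτiso : ∀ u v : V, τ u = true → τ v = true → ¬ G.Adj u v) :
    Ham G σ τ
      = ((1 - (a : ℂ)) * (N : ℂ) * (j : ℂ) / 8) * (if σ = τ then 1 else 0)
        + star (Ja a *ᵥ Pi.single σ 1) ⬝ᵥ (kron a (H1 G) *ᵥ (Ja a *ᵥ Pi.single τ 1)) := by
  subst hN hσa
  rw [star_Ja_dotProduct_kron_mulVec, ham_apply_of_isolated G hreg σ τ hσiso]
  have hrow : ∀ x, (if σ x = true then
      ∑ y, H1 G x y * (if (y = x ∨ σ y = false) ∧ τ = σ ∘ Equiv.swap x y then 1 else 0) else 0)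
      = 1 / 2 * (∑ y, if σ x = true ∧ σ y = false ∧ τ = σ ∘ Equiv.swap x y ∧ G.Adj x y
          then (1 : ℂ) else 0)
        + ((Fintype.card V : ℂ) * j / 8 - (j : ℂ) / 2) * (if σ = τ then 1 else 0) *
          (if σ x = true then 1 else 0) := by
    intro x
    cases hx : σ x
    · simp
    · have hdiag : ∑ y, (if x = y then (1 : ℂ) else 0) *
          (if (y = x ∨ σ y = false) ∧ τ = σ ∘ Equiv.swap x y then 1 else 0)
          = if σ = τ then 1 else 0 := by
        rw [Fintype.sum_eq_single x fun y hy => by simp [hy.symm]]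
        simp [eq_comm (a := σ)]
      simp only [if_true, true_and, mul_one, H1_apply G hreg, add_mul, Finset.sum_add_distrib,
        mul_assoc, ← Finset.mul_sum, hdiag]
      congr 2
      refine Finset.sum_congr rfl fun y _ => ?_
      by_cases hxy : G.Adj x y
      · simp [hxy, hxy.ne']
      · simp [hxy]
  have hcard : ∑ x, (if σ x = true then (1 : ℂ) else 0) = (downCard σ : ℂ) := by
    rw [Finset.sum_boole, downCard]
  simp only [hrow, Finset.sum_add_distrib, ← Finset.mul_sum, hcard]
  ring
end

section
/- (Independent magnons for the XXZ model) Fix Δ ≥ 0 and let H₁^Δ be the one-magnon block of the XXZ Hamiltonian H_Δ with smallest eigenvalue E₁^Δ. Let x_1, …, x_a ∈ ℂ^V be nonzero vectors with H₁^Δ x_i = E₁^Δ x_i whose supports are pairwise disjoint and mutually non-adjacent in G. Then Φ = Σ_{n_1,…,n_a} x_1(n_1)⋯x_a(n_a) · e_{σ(n_1,…,n_a)} (sum over n_i in the support of x_i; σ(n_1,…,n_a) the configuration with down-set {n_1,…,n_a}) is a nonzero eigenvector of H_Δ with eigenvalue Δ·(1−a)·N·j/8 + a·E₁^Δ, which equals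 the smallest eigenvalue of H_Δ on ℋ_a. -/
open Matrix BigOperators
open scoped ComplexOrder

variable {V : Type*}

/-- The spin-1/2 XXZ Hamiltonian `H_Δ`, defined by its matrix elements:
`⟨e_σ, H_Δ e_σ⟩ = (Δ/4)·(L − 2·e(A_σ, V∖A_σ))` and `⟨e_τ, H_Δ e_σ⟩ = 1/2` iff `τ` arises from `σ`
by interchanging the unequal spin values at the endpoints of an edge. -/
noncomputable def HamXXZ [Fintype V] [DecidableEq V] (G : SimpleGraph V) [DecidableRel G.Adj]
    (Δ : ℝ) : Matrix (Conf V) (Conf V) ℂ :=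
  Matrix.of fun τ σ =>
    if τ = σ then ((Δ : ℂ)/4) * ((G.edgeFinset.card : ℂ) - 2 * crossCount G σ)
    else if ∃ u v : V, G.Adj u v ∧ σ u ≠ σ v ∧ τ = σ ∘ (Equiv.swap u v) then 1/2 else 0

/-- The one-magnon block `H₁^Δ` of the XXZ Hamiltonian. -/
noncomputable def H1XXZ [Fintype V] [DecidableEq V] (G : SimpleGraph V) [DecidableRel G.Adj]
    (Δ : ℝ) : Matrix V V ℂ :=
  Matrix.of fun m n => HamXXZ G Δ (singleDown m) (singleDown n)

/-- Directed edges leaving the down-set of `τ`. -/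
def outEdges [Fintype V] (G : SimpleGraph V) [DecidableRel G.Adj]
    (τ : Conf V) : Finset (V × V) :=
  Finset.univ.filter fun p => G.Adj p.1 p.2 ∧ τ p.1 = true ∧ τ p.2 = false

lemma crossCount_eq_card_outEdges [Fintype V] [DecidableEq V]
    (G : SimpleGraph V) [DecidableRel G.Adj] (τ : Conf V) :
    crossCount G τ = (outEdges G τ).card := by
  have himage : {e : Sym2 V | e ∈ G.edgeSet ∧
      ∃ u v : V, τ u = true ∧ τ v = false ∧ e = s(u, v)} =
      (((outEdges G τ).image fun p => s(p.1, p.2) : Finset (Sym2 V)) : Set (Sym2 V)) := by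
    ext e
    simp only [Set.mem_ofPred_eq, Finset.coe_image, Set.mem_image, Finset.mem_coe, outEdges,
      Finset.mem_filter, Finset.mem_univ, true_and, Prod.exists]
    constructor
    · rintro ⟨he, u, v, hu, hv, rfl⟩
      exact ⟨u, v, ⟨he, hu, hv⟩, rfl⟩
    · rintro ⟨u, v, ⟨he, hu, hv⟩, rfl⟩
      exact ⟨he, u, v, hu, hv, rfl⟩
  rw [crossCount, himage, Set.ncard_coe_finset, Finset.card_image_of_injOn]
  rintro ⟨u, v⟩ hp ⟨u', v'⟩ hq h
  simp only [outEdges, Finset.coe_filter, Finset.mem_univ, true_and, Set.mem_ofPred_eq] at hp hq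
  rcases Sym2.eq_iff.1 h with ⟨h1, h2⟩ | ⟨h1, h2⟩
  · exact Prod.ext h1 h2
  · grind

lemma comp_swap_apply_of_down [DecidableEq V] {τ : Conf V} {u v : V}
    (hu : τ u = true) (hv : τ v = false) (w : V) :
    (τ ∘ Equiv.swap u v) w = if w = u then false else if w = v then true else τ w := by
  rw [Function.comp_apply, Equiv.swap_apply_def]
  split_ifs
  exacts [hv, hu, rfl]

lemma hamXXZ_mulVec_apply [Fintype V] [DecidableEq V]
    (G : SimpleGraph V) [DecidableRel G.Adj] (Δ : ℝ) (ψ : Conf V → ℂ) (τ : Conf V) :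
    (HamXXZ G Δ *ᵥ ψ) τ =
      (Δ : ℂ) / 4 * (G.edgeFinset.card - 2 * (outEdges G τ).card) * ψ τ +
        1 / 2 * ∑ p ∈ outEdges G τ, ψ (τ ∘ Equiv.swap p.1 p.2) := by
  have hinj : Set.InjOn (fun p : V × V => τ ∘ Equiv.swap p.1 p.2) (outEdges G τ) := by
    rintro ⟨u, v⟩ hp ⟨u', v'⟩ hq h
    simp only [outEdges, Finset.coe_filter, Finset.mem_univ, true_and, Set.mem_ofPred_eq] at hp hq
    have key := fun w => congrFun h w
    simp only [comp_swap_apply_of_down hp.2.1 hp.2.2,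
      comp_swap_apply_of_down hq.2.1 hq.2.2] at key
    have h1 := key u
    have h2 := key v
    grind
  have hne : ∀ σ ∈ (outEdges G τ).image (fun p => τ ∘ Equiv.swap p.1 p.2), τ ≠ σ := by
    simp only [outEdges, Finset.mem_image, Finset.mem_filter, Finset.mem_univ, true_and]
    rintro σ ⟨p, hp, rfl⟩ h
    have := congrFun h p.1
    rw [comp_swap_apply_of_down hp.2.1 hp.2.2, hp.2.1, if_pos rfl] at this
    exact Bool.noConfusion this
  have hiff : ∀ σ, (τ ≠ σ ∧ ∃ u v : V, G.Adj u v ∧ σ u ≠ σ v ∧ τ = σ ∘ Equiv.swap u v) ↔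
      σ ∈ (outEdges G τ).image (fun p => τ ∘ Equiv.swap p.1 p.2) := by
    intro σ
    constructor
    · rintro ⟨-, u, v, huv, hσ, rfl⟩
      have hback : σ = (σ ∘ Equiv.swap u v) ∘ Equiv.swap u v := by
        ext w; simp
      simp only [Finset.mem_image, outEdges, Finset.mem_filter, Finset.mem_univ, true_and]
      cases hu : σ u with
      | true =>
        refine ⟨(v, u), ⟨huv.symm, by simp [hu], ?_⟩, ?_⟩
        · simpa [hu] using hσ
        · rw [Equiv.swap_comm v u]; exact hback.symm
      | false =>
        refine ⟨(u, v), ⟨huv, ?_, by simp [hu]⟩, hback.symm⟩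
        simpa [hu] using hσ
    · intro h
      refine ⟨hne σ h, ?_⟩
      simp only [Finset.mem_image, outEdges, Finset.mem_filter, Finset.mem_univ, true_and] at h
      obtain ⟨p, hp, rfl⟩ := h
      refine ⟨p.1, p.2, hp.1, by simp [hp.2], ?_⟩
      ext w; simp
  have hsplit : ∀ σ, HamXXZ G Δ τ σ * ψ σ =
      (if τ = σ then
        (Δ : ℂ) / 4 * (G.edgeFinset.card - 2 * (outEdges G τ).card) * ψ τ else 0) +
      if σ ∈ (outEdges G τ).image (fun p => τ ∘ Equiv.swap p.1 p.2) then 1 / 2 * ψ σ else 0 := by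
    intro σ
    simp only [← hiff, HamXXZ, Matrix.of_apply, crossCount_eq_card_outEdges]
    by_cases h : τ = σ
    · subst h; simp
    · by_cases h' : ∃ u v : V, G.Adj u v ∧ σ u ≠ σ v ∧ τ = σ ∘ Equiv.swap u v
      · simp only [h, h', if_true, if_false, zero_add, ne_eq, not_false_eq_true, and_self]
      · simp only [h, h', if_false, zero_add, and_false, zero_mul]
  simp only [Matrix.mulVec, dotProduct, hsplit, Finset.sum_add_distrib, Finset.sum_ite_eq,
    Finset.mem_univ, if_true]
  rw [← Finset.sum_filter, Finset.filter_mem_eq_inter, Finset.univ_inter,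
    Finset.sum_image hinj, Finset.mul_sum]

lemma H1XXZ_apply [Fintype V] [DecidableEq V]
    (G : SimpleGraph V) [DecidableRel G.Adj] {j : ℕ} (hreg : G.IsRegularOfDegree j)
    (Δ : ℝ) (m n : V) :
    H1XXZ G Δ m n = (if m = n then (Δ : ℂ) / 4 * (G.edgeFinset.card - 2 * j) else 0) +
      if G.Adj m n then 1 / 2 else 0 := by
  have hcard : (outEdges G (singleDown n)).card = j := by
    rw [← hreg n, ← SimpleGraph.card_neighborFinset_eq_degree]
    refine Finset.card_nbij' (fun p => p.2) (fun u => (n, u)) ?_ ?_ ?_ ?_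
    · rintro ⟨u, v⟩ h
      simp [outEdges, singleDown] at h ⊢
      grind
    · intro u h
      have h : G.Adj n u := by simpa using h
      simp [outEdges, singleDown, h, h.ne']
    · rintro ⟨u, v⟩ h
      simp [outEdges, singleDown] at h ⊢
      grind
    · intro u h; rfl
  have hsd : singleDown m = singleDown n ↔ m = n := by
    refine ⟨fun h => ?_, fun h => by rw [h]⟩
    have := congrFun h m
    simpa [singleDown] using this
  simp only [H1XXZ, HamXXZ, Matrix.of_apply, crossCount_eq_card_outEdges, hcard, hsd]
  by_cases h : m = n
  · subst h; simp
  · have : (∃ u v : V, G.Adj u v ∧ singleDown n u ≠ singleDown n v ∧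
        singleDown m = singleDown n ∘ Equiv.swap u v) ↔ G.Adj m n := by
      constructor
      · rintro ⟨u, v, huv, -, hm⟩
        have := congrFun hm m
        simp only [singleDown, decide_true, Function.comp_apply, eq_comm (a := true),
          Equiv.swap_apply_def] at this
        have := huv.symm
        grind
      · intro hmn
        refine ⟨m, n, hmn, by simp [singleDown, h], ?_⟩
        ext w
        simp only [singleDown, Function.comp_apply, Equiv.swap_apply_def]
        grind
    simp [h, this]

/-- Add a magnon at `v` to `B` and read off `ψ`; the value is `0` if `v` is already down. -/
def addMagnon [DecidableEq V] (ψ : Conf V → ℂ) (B : Conf V) : V → ℂ :=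
  fun v => if B v = true then 0 else ψ (Function.update B v true)

lemma hamXXZ_mulVec_eq_sum_H1XXZ [Fintype V] [DecidableEq V]
    (G : SimpleGraph V) [DecidableRel G.Adj] {j : ℕ} (hreg : G.IsRegularOfDegree j)
    (Δ : ℝ) (ψ : Conf V → ℂ) (τ : Conf V) :
    (HamXXZ G Δ *ᵥ ψ) τ =
      (Δ : ℂ) / 4 * G.edgeFinset.card * (1 - downCard τ) * ψ τ +
      (∑ v with τ v = true, (H1XXZ G Δ *ᵥ addMagnon ψ (Function.update τ v false)) v) +
      (Δ : ℂ) / 2 * (∑ v with τ v = true, ((G.neighborFinset v).filter (τ · = true)).card : ℕ) *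
        ψ τ := by
  have hdeg : ∀ v, ((G.neighborFinset v).filter (τ · = true)).card +
      ((G.neighborFinset v).filter (τ · = false)).card = j := by
    intro v
    rw [← hreg v, ← SimpleGraph.card_neighborFinset_eq_degree,
      ← Finset.card_filter_add_card_filter_not (s := G.neighborFinset v) (τ · = true)]
    simp
  have hout : ∀ {M : Type} [AddCommMonoid M] (f : V × V → M), ∑ p ∈ outEdges G τ, f p =
      ∑ v with τ v = true, ∑ u ∈ (G.neighborFinset v).filter (τ · = false), f (v, u) := by
    intro M _ f
    rw [Finset.sum_sigma']
    refine Finset.sum_nbij' (fun p => ⟨p.1, p.2⟩) (fun p => (p.1, p.2)) ?_ ?_ ?_ ?_ ?_ <;>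
      simp +contextual [outEdges]
  have hcount : (outEdges G τ).card +
      ∑ v with τ v = true, ((G.neighborFinset v).filter (τ · = true)).card = downCard τ * j := by
    rw [Finset.card_eq_sum_ones, hout, ← Finset.sum_add_distrib]
    simp only [← Finset.card_eq_sum_ones]
    rw [Finset.sum_congr rfl fun v _ => (add_comm _ _).trans (hdeg v)]
    simp [downCard]
  have hcount' : ((outEdges G τ).card : ℂ) = downCard τ * j -
      (∑ v with τ v = true, ((G.neighborFinset v).filter (τ · = true)).card : ℕ) := by
    rw [eq_sub_iff_add_eq]; exact_mod_cast hcount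
  have hone : ∀ v ∈ Finset.univ.filter (τ · = true),
      (H1XXZ G Δ *ᵥ addMagnon ψ (Function.update τ v false)) v =
      (Δ : ℂ) / 4 * (G.edgeFinset.card - 2 * j) * ψ τ +
      1 / 2 * ∑ u ∈ (G.neighborFinset v).filter (τ · = false), ψ (τ ∘ Equiv.swap v u) := by
    intro v hv
    have hv : τ v = true := by simpa using hv
    have hself : addMagnon ψ (Function.update τ v false) v = ψ τ := by
      simp [addMagnon, ← hv]
    simp only [Matrix.mulVec, dotProduct, H1XXZ_apply G hreg, add_mul, Finset.sum_add_distrib,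
      ite_mul, zero_mul, Finset.sum_ite_eq, Finset.mem_univ, if_true, hself]
    congr 1
    rw [← Finset.sum_filter, ← Finset.mul_sum, ← SimpleGraph.neighborFinset_eq_filter,
      Finset.sum_filter]
    congr 1
    refine Finset.sum_congr rfl fun u hu => ?_
    have huv : u ≠ v := by
      have : G.Adj v u := by simpa using hu
      exact this.ne'
    cases hτu : τ u with
    | true => simp [addMagnon, huv, hτu]
    | false =>
      simp only [addMagnon, Function.update_of_ne huv, hτu, if_true, Bool.false_eq_true, if_false]
      congr 1
      ext w
      rw [comp_swap_apply_of_down hv hτu]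
      simp only [Function.update_apply]
      grind
  rw [hamXXZ_mulVec_apply, Finset.sum_congr rfl hone, Finset.sum_add_distrib, Finset.sum_const,
    nsmul_eq_mul, hcount', hout, ← Finset.mul_sum]
  change _ = _ + ((downCard τ : ℂ) * _ + _) + _
  ring

lemma sum_down_eq_sum_up_update [Fintype V] [DecidableEq V] {M : Type*} [AddCommMonoid M]
    (g : Conf V → V → M) :
    ∑ τ, ∑ v with τ v = true, g τ v =
      ∑ B : Conf V, ∑ v with B v = false, g (Function.update B v true) v := by
  simp only [Finset.sum_filter]
  rw [Finset.sum_comm, Finset.sum_comm (s := (Finset.univ : Finset (Conf V)))]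
  refine Finset.sum_congr rfl fun v _ => ?_
  rw [← Finset.sum_filter, ← Finset.sum_filter]
  refine Finset.sum_nbij' (fun τ => Function.update τ v false)
    (fun B => Function.update B v true) ?_ ?_ ?_ ?_ ?_
  · simp
  · simp
  · intro τ hτ
    have hτ : τ v = true := by simpa using hτ
    simp [← hτ]
  · intro B hB
    have hB : B v = false := by simpa using hB
    simp [← hB]
  · intro τ hτ
    have hτ : τ v = true := by simpa using hτ
    simp [← hτ]

lemma sum_star_mul_down_eq_sum_addMagnon [Fintype V] [DecidableEq V] (M : Matrix V V ℂ)
    (ψ : Conf V → ℂ) :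
    ∑ τ, star (ψ τ) * ∑ v with τ v = true,
      (M *ᵥ addMagnon ψ (Function.update τ v false)) v =
    ∑ B, star (addMagnon ψ B) ⬝ᵥ (M *ᵥ addMagnon ψ B) := by
  simp only [Finset.mul_sum]
  rw [sum_down_eq_sum_up_update]
  refine Finset.sum_congr rfl fun B _ => ?_
  rw [Finset.sum_filter, dotProduct]
  refine Finset.sum_congr rfl fun v _ => ?_
  cases hB : B v with
  | true => simp [addMagnon, hB]
  | false =>
    have : Function.update B v false = B := by simp [← hB]
    simp [addMagnon, hB, this]

lemma sum_addMagnon_norm_sq [Fintype V] [DecidableEq V] {a : ℕ} {ψ : Conf V → ℂ}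
    (hψ : ∀ σ, ψ σ ≠ 0 → downCard σ = a) :
    ∑ B, star (addMagnon ψ B) ⬝ᵥ addMagnon ψ B = a * (star ψ ⬝ᵥ ψ) := by
  have h := sum_star_mul_down_eq_sum_addMagnon (1 : Matrix V V ℂ) ψ
  simp only [Matrix.one_mulVec] at h
  rw [← h, dotProduct, Finset.mul_sum]
  refine Finset.sum_congr rfl fun τ _ => ?_
  have hself : ∀ v ∈ Finset.univ.filter (τ · = true),
      addMagnon ψ (Function.update τ v false) v = ψ τ := by
    intro v hv
    have hv : τ v = true := by simpa using hv
    simp [addMagnon, ← hv]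
  rw [Finset.sum_congr rfl hself, Finset.sum_const, nsmul_eq_mul]
  change _ * ((downCard τ : ℂ) * _) = _
  by_cases hτ : ψ τ = 0
  · simp [hτ]
  · rw [hψ τ hτ, Pi.star_apply]
    ring

lemma Matrix.IsHermitian.posSemidef_sub_of_isLeast [Fintype V] [DecidableEq V]
    {M : Matrix V V ℂ} (hM : M.IsHermitian) {E : ℝ}
    (hE : IsLeast {E : ℝ | ∃ x : V → ℂ, x ≠ 0 ∧ M *ᵥ x = (E : ℂ) • x} E) :
    (M - (E : ℂ) • (1 : Matrix V V ℂ)).PosSemidef := by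
  have hH : (M - (E : ℂ) • (1 : Matrix V V ℂ)).IsHermitian := by
    refine hM.sub ?_
    simp [Matrix.IsHermitian, Matrix.conjTranspose_smul]
  refine hH.posSemidef_iff_eigenvalues_nonneg.2 fun i => ?_
  have hi := hH.mulVec_eigenvectorBasis i
  have hne : (hH.eigenvectorBasis i).ofLp ≠ 0 := by
    intro h
    exact hH.eigenvectorBasis.orthonormal.ne_zero i (by ext k; exact congrFun h k)
  have heig : M *ᵥ (hH.eigenvectorBasis i).ofLp =
      ((E + hH.eigenvalues i : ℝ) : ℂ) • (hH.eigenvectorBasis i).ofLp := by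
    rw [Matrix.sub_mulVec, Matrix.smul_mulVec, Matrix.one_mulVec, sub_eq_iff_eq_add] at hi
    rw [hi, Complex.ofReal_add, add_smul, add_comm, Complex.coe_smul (hH.eigenvalues i)]
  have hmem := hE.2 ⟨_, hne, heig⟩
  exact nonneg_of_le_add_right hmem

lemma H1XXZ_isHermitian [Fintype V] [DecidableEq V]
    (G : SimpleGraph V) [DecidableRel G.Adj] {j : ℕ} (hreg : G.IsRegularOfDegree j) (Δ : ℝ) :
    (H1XXZ G Δ).IsHermitian := by
  ext m n
  rw [Matrix.conjTranspose_apply, H1XXZ_apply G hreg, H1XXZ_apply G hreg]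
  simp only [eq_comm (a := n) (b := m), G.adj_comm n m]
  split_ifs <;> simp

lemma mul_le_sum_addMagnon [Fintype V] [DecidableEq V] {M : Matrix V V ℂ} {a : ℕ} {E : ℝ}
    (hM : (M - (E : ℂ) • (1 : Matrix V V ℂ)).PosSemidef)
    {ψ : Conf V → ℂ} (hψ : ∀ σ, ψ σ ≠ 0 → downCard σ = a) :
    (E : ℂ) * (a * (star ψ ⬝ᵥ ψ)) ≤ ∑ B, star (addMagnon ψ B) ⬝ᵥ (M *ᵥ addMagnon ψ B) := by
  rw [← sum_addMagnon_norm_sq hψ, Finset.mul_sum]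
  refine Finset.sum_le_sum fun B _ => ?_
  have h := hM.dotProduct_mulVec_nonneg (addMagnon ψ B)
  rw [Matrix.sub_mulVec, Matrix.smul_mulVec, Matrix.one_mulVec, dotProduct_sub,
    dotProduct_smul, smul_eq_mul] at h
  exact sub_nonneg.1 h

lemma le_of_hamXXZ_mulVec_eq [Fintype V] [DecidableEq V]
    (G : SimpleGraph V) [DecidableRel G.Adj] {j : ℕ} (hreg : G.IsRegularOfDegree j)
    {Δ : ℝ} (hΔ : 0 ≤ Δ) {a : ℕ} {E1 E : ℝ}
    (hE1 : IsLeast {E : ℝ | ∃ x : V → ℂ, x ≠ 0 ∧ H1XXZ G Δ *ᵥ x = (E : ℂ) • x} E1)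
    {ψ : Conf V → ℂ} (hψ0 : ψ ≠ 0) (hψ : ∀ σ, ψ σ ≠ 0 → downCard σ = a)
    (hψE : HamXXZ G Δ *ᵥ ψ = (E : ℂ) • ψ) :
    Δ / 4 * G.edgeFinset.card * (1 - a) + a * E1 ≤ E := by
  have hone := mul_le_sum_addMagnon
    ((H1XXZ_isHermitian G hreg Δ).posSemidef_sub_of_isLeast hE1) hψ
  obtain ⟨c, hc⟩ : ∃ c : Conf V → ℕ, ∀ τ, (HamXXZ G Δ *ᵥ ψ) τ =
      (Δ : ℂ) / 4 * G.edgeFinset.card * (1 - downCard τ) * ψ τ +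
      (∑ v with τ v = true, (H1XXZ G Δ *ᵥ addMagnon ψ (Function.update τ v false)) v) +
      (Δ : ℂ) / 2 * (c τ : ℂ) * ψ τ :=
    ⟨_, hamXXZ_mulVec_eq_sum_H1XXZ G hreg Δ ψ⟩
  have hint : 0 ≤ ∑ τ, star (ψ τ) * ((Δ : ℂ) / 2 * (c τ : ℂ) * ψ τ) := by
    refine Finset.sum_nonneg fun τ _ => ?_
    have h1 : (0 : ℂ) ≤ (Δ : ℂ) / 2 * (c τ : ℂ) := by
      have h : (0 : ℝ) ≤ Δ / 2 * (c τ : ℝ) :=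
        mul_nonneg (div_nonneg hΔ zero_le_two) (Nat.cast_nonneg _)
      simpa using Complex.zero_le_real.2 h
    have h2 : 0 ≤ star (ψ τ) * ψ τ := star_mul_self_nonneg _
    calc (0 : ℂ) ≤ (Δ : ℂ) / 2 * (c τ : ℂ) * (star (ψ τ) * ψ τ) := mul_nonneg h1 h2
      _ = _ := by ring
  have hexp : (E : ℂ) * (star ψ ⬝ᵥ ψ) =
      (Δ : ℂ) / 4 * G.edgeFinset.card * (1 - a) * (star ψ ⬝ᵥ ψ) +
      ∑ B, star (addMagnon ψ B) ⬝ᵥ (H1XXZ G Δ *ᵥ addMagnon ψ B) +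
      ∑ τ, star (ψ τ) * ((Δ : ℂ) / 2 * (c τ : ℂ) * ψ τ) := by
    rw [← sum_star_mul_down_eq_sum_addMagnon, ← smul_eq_mul (E : ℂ), ← dotProduct_smul, ← hψE,
      dotProduct, dotProduct, Finset.mul_sum, ← Finset.sum_add_distrib, ← Finset.sum_add_distrib]
    refine Finset.sum_congr rfl fun τ _ => ?_
    rw [hc, Pi.star_apply]
    by_cases hτ : ψ τ = 0
    · simp [hτ]
    · rw [hψ τ hτ]
      ring
  have hpsi : 0 < star ψ ⬝ᵥ ψ := dotProduct_star_self_pos_iff.2 hψ0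
  have hle : (((Δ / 4 * G.edgeFinset.card * (1 - a) + a * E1 : ℝ) : ℂ)) * (star ψ ⬝ᵥ ψ) ≤
      (E : ℂ) * (star ψ ⬝ᵥ ψ) := by
    rw [hexp]
    calc _ = (Δ : ℂ) / 4 * G.edgeFinset.card * (1 - a) * (star ψ ⬝ᵥ ψ) +
          (E1 : ℂ) * (a * (star ψ ⬝ᵥ ψ)) + 0 := by push_cast; ring
      _ ≤ _ := by gcongr
  exact_mod_cast le_of_mul_le_mul_right hle hpsi

/-- The configuration whose down-set is the range of `n`. -/
def downRange {ι : Type*} [Fintype ι] [DecidableEq V] (n : ι → V) : Conf V :=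
  fun w => decide (∃ i, n i = w)

lemma downRange_apply {ι : Type*} [Fintype ι] [DecidableEq V] (n : ι → V) (w : V) :
    downRange n w = true ↔ ∃ i, n i = w := by
  simp [downRange]

/-- The superposition of the configurations with one down spin drawn from each `x i`. -/
noncomputable def magnonProduct {ι : Type*} [Fintype ι] [DecidableEq ι] [Fintype V] [DecidableEq V]
    (x : ι → V → ℂ) : Conf V → ℂ :=
  fun σ => ∑ n : ι → V, if downRange n = σ then ∏ i, x i (n i) else 0

lemma injective_of_prod_ne_zero {ι : Type*} [Fintype ι] {x : ι → V → ℂ}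
    (hdisj : ∀ i k, i ≠ k → ∀ u v : V, x i u ≠ 0 → x k v ≠ 0 → u ≠ v)
    {n : ι → V} (hn : ∏ i, x i (n i) ≠ 0) : Function.Injective n := by
  rw [Finset.prod_ne_zero_iff] at hn
  intro i k hik
  by_contra hne
  exact hdisj i k hne _ _ (hn i (Finset.mem_univ _)) (hn k (Finset.mem_univ _)) hik

section MagnonProduct

variable {ι : Type*} [Fintype ι] [DecidableEq ι] [Fintype V] [DecidableEq V] {x : ι → V → ℂ}

lemma exists_of_magnonProduct_ne_zero {σ : Conf V} (hσ : magnonProduct x σ ≠ 0) :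
    ∃ n : ι → V, downRange n = σ ∧ ∏ i, x i (n i) ≠ 0 := by
  obtain ⟨n, -, hn⟩ := Finset.exists_ne_zero_of_sum_ne_zero hσ
  exact ⟨n, by simpa using hn⟩

lemma downCard_of_magnonProduct_ne_zero
    (hdisj : ∀ i k, i ≠ k → ∀ u v : V, x i u ≠ 0 → x k v ≠ 0 → u ≠ v)
    {σ : Conf V} (hσ : magnonProduct x σ ≠ 0) : downCard σ = Fintype.card ι := by
  obtain ⟨n, rfl, hn⟩ := exists_of_magnonProduct_ne_zero hσ
  rw [← Finset.card_univ, ← Finset.card_image_of_injective _ (injective_of_prod_ne_zero hdisj hn),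
    downCard]
  congr 1
  ext w
  simp [downRange]

lemma magnonProduct_ne_zero
    (hdisj : ∀ i k, i ≠ k → ∀ u v : V, x i u ≠ 0 → x k v ≠ 0 → u ≠ v)
    (hx : ∀ i, x i ≠ 0) : magnonProduct x ≠ 0 := by
  choose n hn using fun i => Function.ne_iff.1 (hx i)
  intro h
  have h := congrFun h (downRange n)
  rw [magnonProduct, Finset.sum_eq_single n, if_pos rfl, Pi.zero_apply,
    Finset.prod_eq_zero_iff] at h
  · obtain ⟨i, -, hi⟩ := h
    exact hn i hi
  · intro m _ hmn
    rw [ite_eq_right_iff]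
    intro hm
    by_contra hprod
    rw [← ne_eq, Finset.prod_ne_zero_iff] at hprod
    refine hmn (funext fun i => ?_)
    obtain ⟨k, hk⟩ := (downRange_apply n (m i)).1 (hm ▸ (downRange_apply m _).2 ⟨i, rfl⟩)
    by_cases hik : i = k
    · rw [← hk, hik]
    · exact absurd hk.symm (hdisj i k hik _ _ (hprod i (Finset.mem_univ _)) (hn k))
  · simp

lemma addMagnon_magnonProduct
    (hdisj : ∀ i k, i ≠ k → ∀ u v : V, x i u ≠ 0 → x k v ≠ 0 → u ≠ v) (B : Conf V) :
    addMagnon (magnonProduct x) B =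
      ∑ i, magnonProduct (fun k : {k // k ≠ i} => x k) B • x i := by
  ext v
  have hn : ∀ n : ι → V,
      (if B v = false ∧ downRange n = Function.update B v true then ∏ i, x i (n i) else 0) =
      ∑ i, if n i = v ∧ downRange (fun k : {k // k ≠ i} => n k) = B
        then ∏ i, x i (n i) else 0 := by
    intro n
    by_cases h0 : ∏ i, x i (n i) = 0
    · simp [h0]
    have hinj := injective_of_prod_ne_zero hdisj h0
    by_cases hv : ∃ i, n i = v
    · obtain ⟨i, rfl⟩ := hv
      rw [Finset.sum_eq_single i (fun k _ hk => if_neg fun h => hk (hinj h.1)) (by simp)]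
      refine if_congr ?_ rfl rfl
      rw [eq_self_iff_true, true_and]
      constructor
      · rintro ⟨hB, h⟩
        ext w
        have hw := congrFun h w
        rw [Bool.eq_iff_iff, downRange_apply] at hw ⊢
        by_cases hwi : w = n i
        · subst hwi
          simp only [hB, Bool.false_eq_true, iff_false]
          rintro ⟨⟨k, hk⟩, hki⟩
          exact hk (hinj hki)
        · rw [Function.update_of_ne hwi] at hw
          rw [← hw]
          constructor
          · rintro ⟨k, hk⟩
            exact ⟨k, hk⟩
          · rintro ⟨k, rfl⟩
            exact ⟨⟨k, fun h => hwi (h ▸ rfl)⟩, rfl⟩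
      · rintro rfl
        refine ⟨?_, ?_⟩
        · rw [← Bool.not_eq_true, downRange_apply]
          rintro ⟨⟨k, hk⟩, hki⟩
          exact hk (hinj hki)
        · ext w
          rw [Bool.eq_iff_iff, downRange_apply]
          by_cases hwi : w = n i
          · subst hwi
            simp
          · rw [Function.update_of_ne hwi, downRange_apply]
            constructor
            · rintro ⟨k, rfl⟩
              exact ⟨⟨k, fun h => hwi (h ▸ rfl)⟩, rfl⟩
            · rintro ⟨k, hk⟩
              exact ⟨k, hk⟩
    · rw [if_neg, Finset.sum_eq_zero]
      · exact fun i _ => if_neg fun h => hv ⟨i, h.1⟩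
      · rintro ⟨-, h⟩
        refine hv ((downRange_apply n v).1 ?_)
        rw [h, Function.update_self]
  have hadd : addMagnon (magnonProduct x) B v = ∑ n : ι → V,
      if B v = false ∧ downRange n = Function.update B v true then ∏ i, x i (n i) else 0 := by
    cases hB : B v <;> simp [addMagnon, magnonProduct, hB]
  rw [hadd, Finset.sum_congr rfl fun n _ => hn n, Finset.sum_comm, Finset.sum_apply]
  refine Finset.sum_congr rfl fun i _ => ?_
  rw [Pi.smul_apply, smul_eq_mul, magnonProduct, Finset.sum_mul,
    Fintype.sum_equiv (Equiv.piSplitAt i fun _ => V) _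
      (fun p => if p.1 = v then
        (if downRange p.2 = B then ∏ k, x (k : {k // k ≠ i}) (p.2 k) else 0) * x i v else 0),
    Fintype.sum_prod_type_right]
  · simp
  · intro n
    simp only [Equiv.piSplitAt_apply, Fintype.prod_eq_mul_prod_subtype_ne _ i]
    by_cases h1 : n i = v
    · simp [h1, mul_comm]
    · simp [h1]

lemma hamXXZ_mulVec_magnonProduct (G : SimpleGraph V) [DecidableRel G.Adj] {j : ℕ}
    (hreg : G.IsRegularOfDegree j) (Δ : ℝ) {E1 : ℂ}
    (hxe : ∀ i, H1XXZ G Δ *ᵥ x i = E1 • x i)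
    (hsep : ∀ i k, i ≠ k → ∀ u v : V, x i u ≠ 0 → x k v ≠ 0 → u ≠ v ∧ ¬ G.Adj u v) :
    HamXXZ G Δ *ᵥ magnonProduct x =
      ((Δ : ℂ) / 4 * G.edgeFinset.card * (1 - Fintype.card ι) + Fintype.card ι * E1) •
        magnonProduct x := by
  have hdisj : ∀ i k, i ≠ k → ∀ u v : V, x i u ≠ 0 → x k v ≠ 0 → u ≠ v :=
    fun i k h u v hu hv => (hsep i k h u v hu hv).1
  have heig : ∀ B, H1XXZ G Δ *ᵥ addMagnon (magnonProduct x) B =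
      E1 • addMagnon (magnonProduct x) B := by
    intro B
    rw [addMagnon_magnonProduct hdisj, Matrix.mulVec_sum, Finset.smul_sum]
    refine Finset.sum_congr rfl fun i _ => ?_
    rw [Matrix.mulVec_smul, hxe, smul_comm]
  ext τ
  have hsum : ∑ v with τ v = true,
      (H1XXZ G Δ *ᵥ addMagnon (magnonProduct x) (Function.update τ v false)) v =
      downCard τ * (E1 * magnonProduct x τ) := by
    rw [downCard, ← nsmul_eq_mul]
    refine Finset.sum_eq_card_nsmul fun v hv => ?_
    have hv : τ v = true := by simpa using hv
    rw [heig]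
    simp [addMagnon, ← hv]
  rw [hamXXZ_mulVec_eq_sum_H1XXZ G hreg, hsum, Pi.smul_apply, smul_eq_mul]
  by_cases hτ : magnonProduct x τ = 0
  · simp [hτ]
  have hzero : ∑ v with τ v = true, ((G.neighborFinset v).filter (τ · = true)).card = 0 := by
    obtain ⟨n, rfl, hn⟩ := exists_of_magnonProduct_ne_zero hτ
    rw [Finset.prod_ne_zero_iff] at hn
    refine Finset.sum_eq_zero fun v hv => ?_
    obtain ⟨i, rfl⟩ := (downRange_apply n v).1 (by simpa using hv)
    rw [Finset.card_eq_zero, Finset.filter_eq_empty_iff]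
    intro u hu hτu
    obtain ⟨k, rfl⟩ := (downRange_apply n u).1 hτu
    have hadj : G.Adj (n i) (n k) := by simpa using hu
    have hik : i ≠ k := fun h => hadj.ne (h ▸ rfl)
    exact (hsep i k hik _ _ (hn i (Finset.mem_univ _)) (hn k (Finset.mem_univ _))).2 hadj
  rw [hzero, downCard_of_magnonProduct_ne_zero hdisj hτ]
  push_cast
  ring

end MagnonProduct

/-- (Independent magnons for the XXZ model) For `Δ ≥ 0`, one-magnon ground states with
pairwise disjoint, mutually non-adjacent supports combine to a nonzero eigenvector of `H_Δ`
with eigenvalue `Δ·(1−a)·N·j/8 + a·E₁^Δ`, which is the smallest eigenvalue of `H_Δ` on `ℋ_a`. -/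
theorem independent_magnons_XXZ [Fintype V] [DecidableEq V]
    (G : SimpleGraph V) [DecidableRel G.Adj] (N j : ℕ)
    (hN : Fintype.card V = N) (hreg : G.IsRegularOfDegree j)
    (Δ : ℝ) (hΔ : 0 ≤ Δ) (a : ℕ) (ha : 1 ≤ a) (E1 : ℝ)
    (hE1 : IsLeast {E : ℝ | ∃ x : V → ℂ, x ≠ 0 ∧ H1XXZ G Δ *ᵥ x = (E : ℂ) • x} E1)
    (x : Fin a → V → ℂ) (hx0 : ∀ i, x i ≠ 0)
    (hxe : ∀ i, H1XXZ G Δ *ᵥ x i = (E1 : ℂ) • x i)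
    (hsep : ∀ i k : Fin a, i ≠ k → ∀ u v : V, x i u ≠ 0 → x k v ≠ 0 →
      u ≠ v ∧ ¬ G.Adj u v)
    (Φ : Conf V → ℂ)
    (hΦ : Φ = ∑ n : Fin a → V, (∏ i, x i (n i)) •
      (Pi.single (fun w => decide (∃ i, n i = w)) 1 : Conf V → ℂ)) :
    Φ ≠ 0
    ∧ HamXXZ G Δ *ᵥ Φ = ((Δ * (1 - (a : ℝ)) * N * j / 8 + a * E1 : ℝ) : ℂ) • Φ
    ∧ IsLeast {E : ℝ | ∃ ψ : Conf V → ℂ, ψ ≠ 0 ∧ (∀ σ, ψ σ ≠ 0 → downCard σ = a)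
        ∧ HamXXZ G Δ *ᵥ ψ = (E : ℂ) • ψ} (Δ * (1 - (a : ℝ)) * N * j / 8 + a * E1) := by
  have hdisj : ∀ i k : Fin a, i ≠ k → ∀ u v : V, x i u ≠ 0 → x k v ≠ 0 → u ≠ v :=
    fun i k h u v hu hv => (hsep i k h u v hu hv).1
  have hΦx : Φ = magnonProduct x := by
    have hrange : ∀ n : Fin a → V, (fun w => decide (∃ i, n i = w)) = downRange n := by
      intro n
      ext w
      simp [downRange]
    ext σ
    simp [hΦ, hrange, magnonProduct, Pi.single_apply, eq_comm (a := σ)]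
  have hL : N * j = 2 * G.edgeFinset.card := by
    rw [← G.sum_degrees_eq_twice_card_edges, Finset.sum_congr rfl fun v _ => hreg v,
      Finset.sum_const, Finset.card_univ, hN, smul_eq_mul]
  have hval : Δ * (1 - (a : ℝ)) * N * j / 8 + a * E1 =
      Δ / 4 * G.edgeFinset.card * (1 - a) + a * E1 := by
    have : (N : ℝ) * j = 2 * G.edgeFinset.card := by exact_mod_cast hL
    linear_combination Δ * (1 - (a : ℝ)) / 8 * this
  have hne : Φ ≠ 0 := hΦx ▸ magnonProduct_ne_zero hdisj hx0
  have heig : HamXXZ G Δ *ᵥ Φ =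
      ((Δ * (1 - (a : ℝ)) * N * j / 8 + a * E1 : ℝ) : ℂ) • Φ := by
    rw [hval, hΦx, hamXXZ_mulVec_magnonProduct G hreg Δ hxe hsep, Fintype.card_fin]
    push_cast
    rfl
  refine ⟨hne, heig, ⟨Φ, hne, fun σ hσ => ?_, heig⟩, ?_⟩
  · rw [hΦx] at hσ
    simpa using downCard_of_magnonProduct_ne_zero hdisj hσ
  · rintro E ⟨ψ, hψ0, hψ, hψE⟩
    rw [hval]
    exact le_of_hamXXZ_mulVec_eq G hreg hΔ hE1 hψ0 hψ hψE
end
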